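/- For every r > 0 and every γ > 0, 𝒱(r,γ) ≤ 𝒢(r,γ), and moreover for each fixed r > 0, lim_{γ→∞} 𝒱(r,γ)/𝒢(r,γ) = 1. -/

import Mathlib

open Filter

/-- `ξ(r,γ)` from the Marčenko–Pastur / Shannon-transform formula. -/
noncomputable def xiFun (r γ : ℝ) : ℝ :=
  1 / 4 * (Real.sqrt (γ * (Real.sqrt r + 1) ^ 2 + 1) -
    Real.sqrt (γ * (Real.sqrt r - 1) ^ 2 + 1)) ^ 2

/-- The function `𝒢(r,γ)` of the paper (asymptotic normalized log-determinant). -/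
noncomputable def calG (r γ : ℝ) : ℝ :=
  1 / 2 * (r * Real.log (1 + γ - xiFun r γ) + Real.log (1 + r * γ - xiFun r γ) -
    xiFun r γ / γ)

/-- `Δ(r) = (1−r)^{1−1/r}` for `0 < r < 1`, with `Δ(1) = 1`. -/
noncomputable def deltaFun (r : ℝ) : ℝ := if r = 1 then 1 else (1 - r) ^ (1 - 1 / r)

/-- The function `𝒱(r,γ)` of the paper. -/
noncomputable def calV (r γ : ℝ) : ℝ :=
  if r ≤ 1 then r / 2 * Real.log (1 + γ / Real.exp 1 * deltaFun r)
  else 1 / 2 * Real.log (1 + r * γ / Real.exp 1 * deltaFun (1 / r))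

/-- `ξ` is the smaller root of `y (γ (r + 1) + 1 - y) = γ² r`. -/
lemma xiFun_quadratic {r γ : ℝ} (hr : 0 < r) (hγ : 0 < γ) :
    xiFun r γ * (γ * (r + 1) + 1 - xiFun r γ) = γ ^ 2 * r ∧
      0 ≤ xiFun r γ ∧ 2 * xiFun r γ ≤ γ * (r + 1) + 1 := by
  have hs := Real.sq_sqrt hr.le
  have hp := Real.sq_sqrt (show 0 ≤ γ * (√r + 1) ^ 2 + 1 by positivity)
  have hq := Real.sq_sqrt (show 0 ≤ γ * (√r - 1) ^ 2 + 1 by positivity)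
  have hp0 := Real.sqrt_nonneg (γ * (√r + 1) ^ 2 + 1)
  have hq0 := Real.sqrt_nonneg (γ * (√r - 1) ^ 2 + 1)
  unfold xiFun
  set p := √(γ * (√r + 1) ^ 2 + 1)
  set q := √(γ * (√r - 1) ^ 2 + 1)
  have hsum : p ^ 2 + q ^ 2 = 2 * (γ * (r + 1) + 1) := by
    rw [hp, hq, ← hs, Real.sqrt_sq (Real.sqrt_nonneg r)]; ring
  have hdiff : p ^ 2 - q ^ 2 = 4 * γ * √r := by rw [hp, hq]; ring
  refine ⟨?_, by positivity, ?_⟩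
  · have hK : γ * (r + 1) + 1 = (p ^ 2 + q ^ 2) / 2 := by linarith
    have hsq : γ ^ 2 * r = (p ^ 2 - q ^ 2) ^ 2 / 16 := by
      rw [hdiff, mul_pow, hs]; ring
    rw [hK, hsq]; ring
  · nlinarith [mul_nonneg hp0 hq0]

/-- The Gaussian value in terms of the fixed point `x` of `x = 1 / (1 + rγ / (1 + γ x))`. -/
lemma exists_calG_eq {r γ : ℝ} (hr : 0 < r) (hγ : 0 < γ) :
    ∃ x : ℝ, 0 < x ∧ x ≤ 1 ∧ (1 - x) * (1 + γ * x) = r * γ * x ∧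
      calG r γ = 1 / 2 * (r * Real.log (1 + γ * x) - Real.log x - (1 - x)) := by
  obtain ⟨hquad, h0, hle⟩ := xiFun_quadratic hr hγ
  have hlt : xiFun r γ < γ := by
    by_contra! h
    nlinarith [mul_nonneg (sub_nonneg.2 h)
      (show 0 ≤ γ * (r + 1) + 1 - xiFun r γ - γ by linarith)]
  obtain ⟨x, hx⟩ : ∃ x, xiFun r γ = γ * (1 - x) := ⟨1 - xiFun r γ / γ, by field_simp; ring⟩
  have hx0 : 0 < x := by
    rw [hx] at hlt
    nlinarith
  have hx1 : x ≤ 1 := by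
    rw [hx] at h0
    linarith [nonneg_of_mul_nonneg_right h0 hγ]
  have hfix : (1 - x) * (1 + γ * x) = r * γ * x := by
    rw [hx] at hquad
    apply mul_left_cancel₀ hγ.ne'
    linear_combination hquad
  refine ⟨x, hx0, hx1, hfix, ?_⟩
  have ha : 1 + γ - xiFun r γ = 1 + γ * x := by rw [hx]; ring
  have hb : 1 + r * γ - xiFun r γ = x⁻¹ := by
    rw [hx]
    apply eq_inv_of_mul_eq_one_left
    linear_combination -hfix
  have hd : xiFun r γ / γ = 1 - x := by rw [hx]; field_simp
  rw [calG, ha, hb, hd, Real.log_inv]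
  ring

lemma deltaFun_pos {r : ℝ} (hr1 : r ≤ 1) : 0 < deltaFun r := by
  unfold deltaFun
  split_ifs with h
  · exact one_pos
  · exact Real.rpow_pos_of_pos (sub_pos.2 (lt_of_le_of_ne hr1 h)) _

/-- `r log (Δ(r) / e)` is the minimum over `x` of `x - 1 - (1 - r) log x`. -/
lemma mul_log_deltaFun_le {r x : ℝ} (hr : 0 < r) (hr1 : r ≤ 1) (hx : 0 < x) :
    r * Real.log (deltaFun r / Real.exp 1) ≤ x - 1 - (1 - r) * Real.log x := by
  rw [Real.log_div (deltaFun_pos hr1).ne' (Real.exp_pos 1).ne', Real.log_exp]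
  unfold deltaFun
  split_ifs with h
  · subst h
    simp [hx.le]
  · have h1 : 0 < 1 - r := sub_pos.2 (lt_of_le_of_ne hr1 h)
    have hlog := Real.log_le_sub_one_of_pos (div_pos hx h1)
    rw [Real.log_div hx.ne' h1.ne'] at hlog
    have hmul := mul_le_mul_of_nonneg_left hlog h1.le
    have hdiv : (1 - r) * (x / (1 - r) - 1) = x - (1 - r) := by field_simp
    rw [hdiv] at hmul
    rw [Real.log_rpow h1]
    have hexp : r * ((1 - 1 / r) * Real.log (1 - r) - 1) = (r - 1) * Real.log (1 - r) - r := by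
      field_simp
    rw [hexp]
    linarith

lemma calV_of_le_one {r : ℝ} (hr1 : r ≤ 1) (γ : ℝ) :
    calV r γ = r / 2 * Real.log (1 + γ * (deltaFun r / Real.exp 1)) := by
  rw [calV, if_pos hr1, div_mul_eq_mul_div γ, mul_div_assoc γ]

lemma calV_le_calG_of_le_one {r γ : ℝ} (hr : 0 < r) (hr1 : r ≤ 1) (hγ : 0 < γ) :
    calV r γ ≤ calG r γ := by
  obtain ⟨x, hx0, hx1, -, hG⟩ := exists_calG_eq hr hγ
  have hmin := mul_log_deltaFun_le hr hr1 hx0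
  have hc : 0 < deltaFun r / Real.exp 1 := div_pos (deltaFun_pos hr1) (Real.exp_pos 1)
  rw [calV_of_le_one hr1, hG]
  set c := deltaFun r / Real.exp 1
  rcases le_total c x with h | h
  · have hlog : Real.log (1 + γ * c) ≤ Real.log (1 + γ * x) :=
      Real.log_le_log (by positivity) (by gcongr)
    have hmul := mul_le_mul_of_nonneg_left hlog hr.le
    linarith [Real.log_le_sub_one_of_pos hx0]
  · have hlog : Real.log (x * (1 + γ * c)) ≤ Real.log (c * (1 + γ * x)) :=
      Real.log_le_log (by positivity) (by linarith)
    rw [Real.log_mul hx0.ne' (by positivity), Real.log_mul hc.ne' (by positivity)] at hlog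
    have hmul := mul_le_mul_of_nonneg_left hlog hr.le
    linarith

lemma calG_le {r γ : ℝ} (hr : 0 < r) (hγ : 0 < γ) :
    calG r γ ≤ r / 2 * Real.log (1 + γ) := by
  obtain ⟨x, hx0, hx1, hfix, hG⟩ := exists_calG_eq hr hγ
  have ha : 0 < 1 + γ * x := by positivity
  have hconc := strictConcaveOn_log_Ioi.concaveOn.2 (Set.mem_Ioi.2 one_pos)
    (Set.mem_Ioi.2 (inv_pos.2 hx0)) (show 0 ≤ 1 / (1 + γ * x) by positivity)
    (show 0 ≤ γ * x / (1 + γ * x) by positivity) (by field_simp)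
  have hcomb : 1 / (1 + γ * x) * 1 + γ * x / (1 + γ * x) * x⁻¹ = (1 + γ) / (1 + γ * x) := by
    field_simp
  simp only [smul_eq_mul] at hconc
  rw [hcomb, Real.log_one, mul_zero, zero_add, Real.log_inv,
    Real.log_div (by positivity) ha.ne'] at hconc
  have hw : r * (γ * x / (1 + γ * x)) = 1 - x := by
    rw [← mul_div_assoc, div_eq_iff ha.ne']
    linarith
  have hmul := mul_le_mul_of_nonneg_left hconc hr.le
  rw [← mul_assoc, hw] at hmul
  have hlog := Real.log_le_sub_one_of_pos (inv_pos.2 hx0)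
  rw [Real.log_inv] at hlog
  have hlog' := mul_le_mul_of_nonneg_left hlog hx0.le
  have hinv : x * (x⁻¹ - 1) = 1 - x := by field_simp
  rw [hinv] at hlog'
  rw [hG]
  linarith

lemma tendsto_calV_div_calG_of_le_one {r : ℝ} (hr : 0 < r) (hr1 : r ≤ 1) :
    Tendsto (fun γ : ℝ => calV r γ / calG r γ) atTop (nhds 1) := by
  have hc : 0 < deltaFun r / Real.exp 1 := div_pos (deltaFun_pos hr1) (Real.exp_pos 1)
  have hVpos {γ : ℝ} (hγ : 0 < γ) : 0 < calV r γ := by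
    rw [calV_of_le_one hr1]
    exact mul_pos (by positivity) (Real.log_pos (by linarith [mul_pos hγ hc]))
  have hc1 : deltaFun r / Real.exp 1 ≤ 1 := by
    have h := (calV_le_calG_of_le_one hr hr1 one_pos).trans (calG_le hr one_pos)
    rw [calV_of_le_one hr1, mul_le_mul_iff_right₀ (by positivity),
      Real.log_le_log_iff (by positivity) (by positivity)] at h
    linarith
  have hlim : Tendsto (fun γ : ℝ => 1 + Real.log (deltaFun r / Real.exp 1) / Real.log (1 + γ))
      atTop (nhds 1) := by
    simpa using ((Real.tendsto_log_atTop.comp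
      (tendsto_atTop_add_const_left atTop 1 tendsto_id)).const_div_atTop
        (Real.log (deltaFun r / Real.exp 1))).const_add 1
  refine tendsto_of_tendsto_of_tendsto_of_le_of_le' hlim tendsto_const_nhds ?_ ?_
  · filter_upwards [eventually_gt_atTop 0] with γ hγ
    have hL : 0 < Real.log (1 + γ) := Real.log_pos (by linarith)
    have hVG := calV_le_calG_of_le_one hr hr1 hγ
    have hlog : Real.log (deltaFun r / Real.exp 1) + Real.log (1 + γ) ≤
        Real.log (1 + γ * (deltaFun r / Real.exp 1)) := by
      rw [← Real.log_mul hc.ne' (by positivity)]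
      exact Real.log_le_log (by positivity) (by linarith)
    calc 1 + Real.log (deltaFun r / Real.exp 1) / Real.log (1 + γ)
        = (Real.log (deltaFun r / Real.exp 1) + Real.log (1 + γ)) / Real.log (1 + γ) := by
          field_simp; ring
      _ ≤ Real.log (1 + γ * (deltaFun r / Real.exp 1)) / Real.log (1 + γ) := by gcongr
      _ = calV r γ / (r / 2 * Real.log (1 + γ)) := by
          rw [calV_of_le_one hr1]; field_simp
      _ ≤ calV r γ / calG r γ :=
          div_le_div_of_nonneg_left (hVpos hγ).le ((hVpos hγ).trans_le hVG) (calG_le hr hγ)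
  · filter_upwards [eventually_gt_atTop 0] with γ hγ
    have hVG := calV_le_calG_of_le_one hr hr1 hγ
    exact (div_le_one ((hVpos hγ).trans_le hVG)).2 hVG

lemma xiFun_inv {r : ℝ} (hr : 0 < r) (γ : ℝ) : xiFun (1 / r) (r * γ) = xiFun r γ := by
  have hs : √r ≠ 0 := (Real.sqrt_pos.2 hr).ne'
  have hplus : r * γ * (√(1 / r) + 1) ^ 2 = γ * (√r + 1) ^ 2 := by
    rw [one_div, Real.sqrt_inv]
    nth_rewrite 1 [← Real.sq_sqrt hr.le]
    field_simp
    ring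
  have hminus : r * γ * (√(1 / r) - 1) ^ 2 = γ * (√r - 1) ^ 2 := by
    rw [one_div, Real.sqrt_inv]
    nth_rewrite 1 [← Real.sq_sqrt hr.le]
    field_simp
    ring
  rw [xiFun, xiFun, hplus, hminus]

lemma calG_inv {r : ℝ} (hr : 0 < r) (γ : ℝ) : calG (1 / r) (r * γ) = 1 / r * calG r γ := by
  rw [calG, calG, xiFun_inv hr, ← mul_assoc, one_div_mul_cancel hr.ne', one_mul]
  field_simp
  ring

lemma calV_inv {r : ℝ} (hr : 1 < r) (γ : ℝ) : calV (1 / r) (r * γ) = 1 / r * calV r γ := by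
  have h : 1 / r ≤ 1 := (div_le_one (by linarith)).2 hr.le
  rw [calV, calV, if_pos h, if_neg hr.not_ge]
  ring

/-- Comparison asserted after Proposition 6 of the paper: `𝒱(r,γ) ≤ 𝒢(r,γ)` and, for each
fixed `r > 0`, `𝒱(r,γ)/𝒢(r,γ) → 1` as `γ → ∞`. -/
theorem stmt13 (r : ℝ) (hr : 0 < r) :
    (∀ γ : ℝ, 0 < γ → calV r γ ≤ calG r γ) ∧
      Tendsto (fun γ : ℝ => calV r γ / calG r γ) atTop (nhds 1) := by
  rcases le_or_gt r 1 with hr1 | hr1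
  · exact ⟨fun γ hγ => calV_le_calG_of_le_one hr hr1 hγ, tendsto_calV_div_calG_of_le_one hr hr1⟩
  · have hinv : 0 < 1 / r := by positivity
    have hinv1 : 1 / r ≤ 1 := (div_le_one hr).2 hr1.le
    refine ⟨fun γ hγ => ?_, ?_⟩
    · have h := calV_le_calG_of_le_one hinv hinv1 (mul_pos hr hγ)
      rw [calV_inv hr1, calG_inv hr] at h
      exact le_of_mul_le_mul_left h hinv
    · have h := (tendsto_calV_div_calG_of_le_one hinv hinv1).comp
        (tendsto_id.const_mul_atTop hr)
      refine h.congr fun γ => ?_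
      simp only [Function.comp_apply, id_eq]
      rw [calV_inv hr1, calG_inv hr, mul_div_mul_left _ _ hinv.ne']
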